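/- arXiv:1701.01529 — 3 statements merged into one kernel-verified Lean document; each statement's English description precedes it below -/
import Mathlib

section
/- Let ω₁, ω₂, ω₃ : ℝ⁴ → ℝ be Schwartz functions, where points of ℝ⁴ are written (x⁰,x¹,x²,x³) and ∂ᵢ denotes the partial derivative in the xⁱ variable. If Σ_{i=1}^{3} ∫_{ℝ⁴} (∂₀ωᵢ)² dλ + Σ_{1≤i<j≤3} ∫_{ℝ⁴} (∂ᵢωⱼ − ∂ⱼωᵢ)² dλ = 0 (λ is Lebesgue measure on ℝ⁴), then ω₁ = ω₂ = ω₃ = 0. In other words, the bilinear form (ω, η) ↦ ⟨dω, dη⟩_{L²} on Schwartz 1-forms Σ_{i=1}^{3} ωᵢ dxⁱ on ℝ⁴ (axial gauge: no dx⁰ component) is positive definite. -/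
open MeasureTheory

/-- The partial derivative in the `i`-th coordinate direction of a function on `ℝ⁴`. -/
noncomputable def pd (i : Fin 4) (f : (Fin 4 → ℝ) → ℝ) (x : Fin 4 → ℝ) : ℝ :=
  fderiv ℝ f x (Pi.single i 1)

open scoped LineDeriv

/-- A Schwartz function whose directional derivative in a nonzero direction vanishes
identically is zero. -/
theorem SchwartzMap.eq_zero_of_lineDerivOp_eq_zero {E F : Type*} [NormedAddCommGroup E]
    [NormedSpace ℝ E] [ProperSpace E] [NormedAddCommGroup F] [NormedSpace ℝ F]
    (f : SchwartzMap E F) {v : E} (hv : v ≠ 0) (hf : ∂_{v} f = 0) : f = 0 := by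
  ext x
  have hderiv (t : ℝ) : HasDerivAt (fun t : ℝ => f (x + t • v)) 0 t := by
    have hline : HasDerivAt (fun t : ℝ => x + t • v) v t := by
      simpa using ((hasDerivAt_id t).smul_const v).const_add x
    have hcomp := f.differentiableAt.hasFDerivAt.comp_hasDerivAt t hline
    rwa [← SchwartzMap.lineDerivOp_apply_eq_fderiv, hf] at hcomp
  have hconst (t : ℝ) : f (x + t • v) = f x := by
    simpa using is_const_of_deriv_eq_zero (fun t => (hderiv t).differentiableAt)
      (fun t => (hderiv t).deriv) t 0
  have hline : Filter.Tendsto (fun t : ℝ => x + t • v) Filter.atTop (Filter.cocompact E) := by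
    rw [← Metric.cobounded_eq_cocompact, ← tendsto_norm_atTop_iff_cobounded]
    refine Filter.tendsto_atTop_mono (f := fun t : ℝ => t * ‖v‖ - ‖x‖) (fun t => ?_)
      (Filter.tendsto_atTop_add_const_right _ _
        (Filter.tendsto_id.atTop_mul_const (norm_pos_iff.2 hv)))
    have htri := norm_sub_le (x + t • v) x
    rw [add_sub_cancel_left, norm_smul, Real.norm_eq_abs] at htri
    nlinarith [mul_le_mul_of_nonneg_right (le_abs_self t) (norm_nonneg v)]
  have hlim := f.tendsto_cocompact.comp hline
  simp only [Function.comp_def, hconst] at hlim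
  exact tendsto_nhds_unique tendsto_const_nhds hlim

/-- A real Schwartz function with vanishing `L²` norm is zero. -/
theorem SchwartzMap.eq_zero_of_integral_sq_eq_zero {E : Type*} [NormedAddCommGroup E]
    [NormedSpace ℝ E] [MeasurableSpace E] [BorelSpace E] [SecondCountableTopology E]
    {μ : Measure E} [μ.HasTemperateGrowth] [μ.IsOpenPosMeasure]
    (f : SchwartzMap E ℝ) (hf : ∫ x, f x ^ 2 ∂μ = 0) : f = 0 := by
  have hae : (fun x => f x ^ 2) =ᵐ[μ] 0 :=
    (integral_eq_zero_iff_of_nonneg (fun x => sq_nonneg (f x)) (f.memLp 2 μ).integrable_sq).1 hf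
  have heq := (Continuous.ae_eq_iff_eq μ (f.continuous.pow 2) continuous_zero).1 hae
  ext x
  exact pow_eq_zero_iff two_ne_zero |>.1 (congrFun heq x)

theorem SchwartzMap.eq_zero_of_integral_pd_sq_eq_zero (f : SchwartzMap (Fin 4 → ℝ) ℝ) (i : Fin 4)
    (hf : ∫ x, pd i f x ^ 2 = 0) : f = 0 := by
  have hne : (Pi.single i 1 : Fin 4 → ℝ) ≠ 0 := by simp
  refine f.eq_zero_of_lineDerivOp_eq_zero hne (eq_zero_of_integral_sq_eq_zero (μ := volume) _ ?_)
  simpa only [SchwartzMap.lineDerivOp_apply_eq_fderiv, pd] using hf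

/-- The bilinear form `(ω, η) ↦ ⟨dω, dη⟩_{L²}` on Schwartz 1-forms
`Σ_{i=1}^{3} ωᵢ dxⁱ` on `ℝ⁴` (axial gauge) is positive definite: if the squared `L²` norm of
`dω` vanishes, then `ω = 0`. -/
theorem stmt0 (ω₁ ω₂ ω₃ : SchwartzMap (Fin 4 → ℝ) ℝ)
    (h : (∫ x : Fin 4 → ℝ, (pd 0 (⇑ω₁) x) ^ 2)
        + (∫ x : Fin 4 → ℝ, (pd 0 (⇑ω₂) x) ^ 2)
        + (∫ x : Fin 4 → ℝ, (pd 0 (⇑ω₃) x) ^ 2)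
        + (∫ x : Fin 4 → ℝ, (pd 1 (⇑ω₂) x - pd 2 (⇑ω₁) x) ^ 2)
        + (∫ x : Fin 4 → ℝ, (pd 1 (⇑ω₃) x - pd 3 (⇑ω₁) x) ^ 2)
        + (∫ x : Fin 4 → ℝ, (pd 2 (⇑ω₃) x - pd 3 (⇑ω₂) x) ^ 2) = 0) :
    ω₁ = 0 ∧ ω₂ = 0 ∧ ω₃ = 0 := by
  have nonneg (g : (Fin 4 → ℝ) → ℝ) : 0 ≤ ∫ x, g x ^ 2 :=
    integral_nonneg fun x => sq_nonneg (g x)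
  have h₁ := nonneg (pd 0 ω₁)
  have h₂ := nonneg (pd 0 ω₂)
  have h₃ := nonneg (pd 0 ω₃)
  have h₁₂ := nonneg fun x => pd 1 ω₂ x - pd 2 ω₁ x
  have h₁₃ := nonneg fun x => pd 1 ω₃ x - pd 3 ω₁ x
  have h₂₃ := nonneg fun x => pd 2 ω₃ x - pd 3 ω₂ x
  exact ⟨ω₁.eq_zero_of_integral_pd_sq_eq_zero 0 (by linarith),
    ω₂.eq_zero_of_integral_pd_sq_eq_zero 0 (by linarith),
    ω₃.eq_zero_of_integral_pd_sq_eq_zero 0 (by linarith)⟩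
end

section
/- Let σ : ℝ² → ℝ⁴ be a C² map, let p be an interior point of [0,1]², x = σ(p), and let U ⊆ [0,1]² be a bounded open neighborhood of p such that σ(s,t) ≠ x for all (s,t) in the closure of U other than p. Let 0 ≤ a < b ≤ 3 and let (c,d) be the complementary pair with {a,b,c,d} = {0,1,2,3}. Assume the differential Dσ(p) is injective and the 2×2 matrix J_ab(p) is invertible. Then lim_{κ→∞} ∫_{U} (κ²/4) · e^{−κ²|σ(s,t)−x|²/8} · (∂ₛσ_a·∂ₜσ_b − ∂ₛσ_b·∂ₜσ_a)(s,t) ds dt = 2π · det J_ab(p) / √(det(J_ab(p)ᵀ J_ab(p) + J_cd(p)ᵀ J_cd(p))). -/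
open MeasureTheory Real Filter Matrix

/-- The `2×2` Jacobian matrix `J_ab(s,t)` of a map `σ : ℝ² → ℝ⁴`, with rows
`(∂ₛσ_a, ∂ₜσ_a)` and `(∂ₛσ_b, ∂ₜσ_b)`. -/
noncomputable def Jmat (σ : ℝ × ℝ → Fin 4 → ℝ) (a b : Fin 4) (q : ℝ × ℝ) :
    Matrix (Fin 2) (Fin 2) ℝ :=
  !![fderiv ℝ σ q ((1 : ℝ), (0 : ℝ)) a, fderiv ℝ σ q ((0 : ℝ), (1 : ℝ)) a;
     fderiv ℝ σ q ((1 : ℝ), (0 : ℝ)) b, fderiv ℝ σ q ((0 : ℝ), (1 : ℝ)) b]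

open Topology in
/-- If `f` takes the value `f p` on a compact set only at `p`, and its differential at `p` is
injective, then `f` separates points of the set from `p` at a linear rate. -/
lemma IsCompact.exists_norm_sub_le_mul_norm_sub {E F : Type*} [NormedAddCommGroup E]
    [NormedSpace ℝ E] [FiniteDimensional ℝ E] [NormedAddCommGroup F] [NormedSpace ℝ F]
    {K : Set E} (hK : IsCompact K) {f : E → F} (hf : Continuous f) {f' : E →L[ℝ] F} {p : E}
    (hf' : HasFDerivAt f f' p) (hinj : Function.Injective f')
    (hne : ∀ q ∈ K, q ≠ p → f q ≠ f p) :
    ∃ C : ℝ, 0 < C ∧ ∀ q ∈ K, ‖q - p‖ ≤ C * ‖f q - f p‖ := by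
  refine hK.induction_on (p := fun s => ∃ C : ℝ, 0 < C ∧ ∀ q ∈ s, ‖q - p‖ ≤ C * ‖f q - f p‖)
    ⟨1, one_pos, by simp⟩ ?_ ?_ ?_
  · rintro s t hst ⟨C, hC, h⟩
    exact ⟨C, hC, fun q hq => h q (hst hq)⟩
  · rintro s t ⟨C, hC, h⟩ ⟨D, hD, h'⟩
    refine ⟨C + D, by positivity, fun q hq => ?_⟩
    have hn := norm_nonneg (f q - f p)
    rcases hq with hq | hq
    · nlinarith [h q hq]
    · nlinarith [h' q hq]
  · intro q hq
    by_cases hqp : q = p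
    · subst hqp
      obtain ⟨M, hM, hanti⟩ := LinearMap.exists_antilipschitzWith (f' : E →ₗ[ℝ] F)
        (LinearMap.ker_eq_bot.2 hinj)
      have hM' : (0 : ℝ) < M := hM
      have hlow : ∀ v, ‖v‖ ≤ M * ‖f' v‖ := fun v => by
        simpa using hanti.le_mul_dist v 0
      have ho := hf'.isLittleO.def (c := (2 * M : ℝ)⁻¹) (by positivity)
      refine ⟨_, mem_nhdsWithin_of_mem_nhds ho, 2 * M, by positivity, fun y hy => ?_⟩
      have hy' : ‖f y - f q - f' (y - q)‖ ≤ (2 * M : ℝ)⁻¹ * ‖y - q‖ := hy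
      have h1 := hlow (y - q)
      have h2 : ‖f' (y - q)‖ ≤ ‖f y - f q‖ + ‖f y - f q - f' (y - q)‖ := by
        simpa using norm_sub_le (f y - f q) (f y - f q - f' (y - q))
      have h3 : (M : ℝ) * ((2 * M : ℝ)⁻¹ * ‖y - q‖) = ‖y - q‖ / 2 := by field_simp
      nlinarith [mul_le_mul_of_nonneg_left (h2.trans (add_le_add_right hy' _)) hM'.le]
    · have hpos : 0 < ‖f q - f p‖ := norm_pos_iff.2 (sub_ne_zero.2 (hne q hq hqp))
      set C : ℝ := ‖q - p‖ / ‖f q - f p‖ + 1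
      have hC : 0 < C := by positivity
      have hlt : ‖q - p‖ < C * ‖f q - f p‖ := by
        simp only [C, add_mul, div_mul_cancel₀ _ hpos.ne']
        linarith
      have hev : ∀ᶠ y in 𝓝 q, ‖y - p‖ < C * ‖f y - f p‖ :=
        ContinuousAt.eventually_lt (by fun_prop) (by fun_prop) hlt
      exact ⟨_, mem_nhdsWithin_of_mem_nhds hev, C, hC, fun y hy => le_of_lt hy⟩

/-- The Gaussian integral of a positive definite binary quadratic form. -/
lemma integral_exp_neg_binary_quadratic {A B C : ℝ} (hC : 0 < C) (hD : 0 < A * C - B ^ 2) :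
    ∫ v : ℝ × ℝ, Real.exp (-(A * v.1 ^ 2 + 2 * B * v.1 * v.2 + C * v.2 ^ 2)) =
      π / Real.sqrt (A * C - B ^ 2) := by
  have hsq : ∀ x y : ℝ, Real.exp (-(A * x ^ 2 + 2 * B * x * y + C * y ^ 2)) =
      Real.exp (-((A * C - B ^ 2) / C) * x ^ 2) * Real.exp (-C * (y + B / C * x) ^ 2) := by
    intro x y
    rw [← Real.exp_add]
    congr 1
    field_simp
    ring
  have hinner : ∀ x : ℝ, ∫ y : ℝ, Real.exp (-(A * x ^ 2 + 2 * B * x * y + C * y ^ 2)) =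
      Real.exp (-((A * C - B ^ 2) / C) * x ^ 2) * Real.sqrt (π / C) := by
    intro x
    simp_rw [hsq]
    rw [integral_const_mul, integral_add_right_eq_self (fun y => Real.exp (-C * y ^ 2)),
      integral_gaussian]
  have hint : Integrable
      (fun v : ℝ × ℝ => Real.exp (-(A * v.1 ^ 2 + 2 * B * v.1 * v.2 + C * v.2 ^ 2)))
      (volume.prod volume) := by
    refine (integrable_prod_iff (Continuous.aestronglyMeasurable (by fun_prop))).2 ⟨?_, ?_⟩
    · refine Eventually.of_forall fun x => ?_
      simp_rw [hsq]
      exact ((integrable_exp_neg_mul_sq hC).comp_add_right _).const_mul _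
    · simp_rw [Real.norm_eq_abs, Real.abs_exp, hinner]
      exact (integrable_exp_neg_mul_sq (by positivity)).mul_const _
  rw [Measure.volume_eq_prod, integral_prod _ hint]
  simp_rw [hinner]
  rw [integral_mul_const, integral_gaussian, ← Real.sqrt_mul (by positivity)]
  have : π / ((A * C - B ^ 2) / C) * (π / C) = π ^ 2 / (A * C - B ^ 2) := by
    field_simp
  rw [this, Real.sqrt_div (by positivity), Real.sqrt_sq Real.pi_pos.le]

lemma integrable_exp_neg_mul_norm_sq_prod {c : ℝ} (hc : 0 < c) :
    Integrable (fun v : ℝ × ℝ => Real.exp (-c * ‖v‖ ^ 2)) := by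
  have hc2 : 0 < c / 2 := by positivity
  refine ((integrable_exp_neg_mul_sq hc2).mul_prod (integrable_exp_neg_mul_sq hc2)).mono'
    (Continuous.aestronglyMeasurable (by fun_prop)) (Eventually.of_forall fun v => ?_)
  rw [Real.norm_eq_abs, Real.abs_exp, ← Real.exp_add]
  refine Real.exp_le_exp.2 ?_
  have h1 : v.1 ^ 2 ≤ ‖v‖ ^ 2 := sq_le_sq.2 (by simpa using norm_fst_le v)
  have h2 : v.2 ^ 2 ≤ ‖v‖ ^ 2 := sq_le_sq.2 (by simpa using norm_snd_le v)
  nlinarith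

lemma norm_sq_le_sum_sq {ι : Type*} [Fintype ι] (v : ι → ℝ) : ‖v‖ ^ 2 ≤ ∑ i, v i ^ 2 := by
  have hs : 0 ≤ ∑ i, v i ^ 2 := Finset.sum_nonneg fun i _ => sq_nonneg _
  refine (Real.le_sqrt (norm_nonneg _) hs).1 ((pi_norm_le_iff_of_nonneg (Real.sqrt_nonneg _)).2
    fun i => Real.abs_le_sqrt ?_)
  exact Finset.single_le_sum (f := fun i => v i ^ 2) (fun i _ => sq_nonneg _) (Finset.mem_univ i)

open Topology in
/-- Laplace's method for a Gaussian kernel pulled back along an immersion at `p`. -/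
lemma tendsto_setIntegral_gaussian_kernel {ι : Type*} [Fintype ι] {σ : ℝ × ℝ → ι → ℝ}
    (hσ : Continuous σ) {L : ℝ × ℝ →L[ℝ] ι → ℝ} {p : ℝ × ℝ} (hL : HasFDerivAt σ L p)
    (hinj : Function.Injective L) {U : Set (ℝ × ℝ)} (hU : IsOpen U)
    (hUb : Bornology.IsBounded U) (hpU : p ∈ U)
    (hne : ∀ q ∈ closure U, q ≠ p → σ q ≠ σ p) {g : ℝ × ℝ → ℝ} (hg : Continuous g) :
    Tendsto (fun κ : ℝ => ∫ q in U,
        (κ ^ 2 / 4) * Real.exp (-κ ^ 2 * (∑ i, (σ q i - σ p i) ^ 2) / 8) * g q)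
      atTop (𝓝 (∫ v, 1 / 4 * Real.exp (-(∑ i, L v i ^ 2) / 8) * g p)) := by
  have hcpt : IsCompact (closure U) := hUb.isCompact_closure
  obtain ⟨C, hC, hlow⟩ := hcpt.exists_norm_sub_le_mul_norm_sub hσ hL hinj hne
  obtain ⟨M, hM⟩ := hcpt.exists_bound_of_continuousOn hg.continuousOn
  have hM0 : 0 ≤ M := (norm_nonneg _).trans (hM p (subset_closure hpU))
  set h : ℝ → ℝ × ℝ → ℝ := fun κ => U.indicator fun q =>
    1 / 4 * Real.exp (-κ ^ 2 * (∑ i, (σ q i - σ p i) ^ 2) / 8) * g q with hh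
  have hscale : ∀ κ : ℝ, 0 < κ → ∫ v, h κ (p + κ⁻¹ • v) = ∫ q in U,
      (κ ^ 2 / 4) * Real.exp (-κ ^ 2 * (∑ i, (σ q i - σ p i) ^ 2) / 8) * g q := by
    intro κ hκ
    rw [Measure.integral_comp_smul volume (fun v => h κ (p + v)) κ⁻¹,
      integral_add_left_eq_self (h κ) p, hh, integral_indicator hU.measurableSet, smul_eq_mul,
      ← integral_const_mul]
    refine integral_congr_ae (Eventually.of_forall fun q => ?_)
    simp only [Module.finrank_prod, Module.finrank_self, inv_pow, inv_inv, abs_pow,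
      abs_of_pos hκ]
    ring
  refine Tendsto.congr' ((eventually_gt_atTop 0).mono hscale) ?_
  refine tendsto_integral_filter_of_dominated_convergence
    (fun v => 1 / 4 * Real.exp (-(8 * C ^ 2)⁻¹ * ‖v‖ ^ 2) * M) ?_ ?_ ?_ ?_
  · refine Eventually.of_forall fun κ => Measurable.aestronglyMeasurable ?_
    have hm : Measurable (h κ) := by
      refine Measurable.indicator (Continuous.measurable ?_) hU.measurableSet
      fun_prop
    exact hm.comp (by fun_prop)
  · filter_upwards [eventually_gt_atTop 0] with κ hκ
    refine Eventually.of_forall fun v => ?_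
    by_cases hv : p + κ⁻¹ • v ∈ U
    · have hv' := subset_closure hv
      simp only [hh, Set.indicator_of_mem hv]
      rw [norm_mul, norm_mul, Real.norm_eq_abs (Real.exp _), Real.abs_exp]
      have hkey : ‖v‖ ^ 2 ≤ C ^ 2 * (κ ^ 2 * ∑ i, (σ (p + κ⁻¹ • v) i - σ p i) ^ 2) := by
        have h1 := hlow _ hv'
        rw [add_sub_cancel_left, norm_smul, Real.norm_eq_abs, abs_of_pos (inv_pos.2 hκ),
          inv_mul_le_iff₀ hκ] at h1
        calc ‖v‖ ^ 2 ≤ (κ * (C * ‖σ (p + κ⁻¹ • v) - σ p‖)) ^ 2 := by gcongr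
          _ = C ^ 2 * (κ ^ 2 * ‖σ (p + κ⁻¹ • v) - σ p‖ ^ 2) := by ring
          _ ≤ _ := by
            gcongr
            simpa using norm_sq_le_sum_sq (σ (p + κ⁻¹ • v) - σ p)
      have hexp : -κ ^ 2 * (∑ i, (σ (p + κ⁻¹ • v) i - σ p i) ^ 2) / 8 ≤
          -(8 * C ^ 2)⁻¹ * ‖v‖ ^ 2 := by
        have h2 : (8 * C ^ 2)⁻¹ * ‖v‖ ^ 2 ≤ (8 * C ^ 2)⁻¹ *
            (C ^ 2 * (κ ^ 2 * ∑ i, (σ (p + κ⁻¹ • v) i - σ p i) ^ 2)) := by gcongr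
        have h3 : (8 * C ^ 2)⁻¹ * (C ^ 2 * (κ ^ 2 * ∑ i, (σ (p + κ⁻¹ • v) i - σ p i) ^ 2)) =
            κ ^ 2 * (∑ i, (σ (p + κ⁻¹ • v) i - σ p i) ^ 2) / 8 := by field_simp
        rw [h3] at h2
        linarith
      have hgM := hM _ hv'
      rw [show ‖(1 / 4 : ℝ)‖ = 1 / 4 by norm_num]
      gcongr
    · simp only [hh, Set.indicator_of_notMem hv, norm_zero]
      positivity
  · exact ((integrable_exp_neg_mul_norm_sq_prod (by positivity)).const_mul _).mul_const _
  · refine Eventually.of_forall fun v => ?_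
    have hline : Tendsto (fun κ : ℝ => p + κ⁻¹ • v) atTop (𝓝 p) := by
      simpa using ((tendsto_inv_atTop_zero (𝕜 := ℝ)).smul_const v).const_add p
    have hdiff : Tendsto (fun κ : ℝ => κ • (σ (p + κ⁻¹ • v) - σ p)) atTop (𝓝 (L v)) :=
      hL.lim_real v
    have hdiff' : ∀ i, Tendsto (fun κ : ℝ => κ * (σ (p + κ⁻¹ • v) i - σ p i)) atTop
        (𝓝 (L v i)) := fun i => tendsto_pi_nhds.1 hdiff i
    have hlim : Tendsto (fun κ : ℝ => 1 / 4 * Real.exp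
        (-(∑ i, (κ * (σ (p + κ⁻¹ • v) i - σ p i)) ^ 2) / 8) * g (p + κ⁻¹ • v)) atTop
        (𝓝 (1 / 4 * Real.exp (-(∑ i, L v i ^ 2) / 8) * g p)) :=
      (((Real.continuous_exp.tendsto _).comp ((tendsto_finsetSum _
        fun i _ => (hdiff' i).pow 2).neg.div_const 8)).const_mul _).mul
        ((hg.tendsto p).comp hline)
    refine hlim.congr' ?_
    filter_upwards [hline.eventually (hU.mem_nhds hpU)] with κ hκ
    simp only [hh, Set.indicator_of_mem hκ, mul_pow, ← Finset.mul_sum, neg_mul]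

/-- Localization lemma for the Gaussian surface kernel: for a `C²` map `σ : ℝ² → ℝ⁴`, an
interior point `p` of `[0,1]²` with `x = σ(p)`, a bounded open neighborhood `U ⊆ [0,1]²` of `p`
on whose closure `σ` takes the value `x` only at `p`, indices `a < b` with complementary pair
`(c,d)`, injective differential at `p` and invertible `J_ab(p)`:
`∫_U (κ²/4) e^{−κ²|σ(s,t)−x|²/8} det J_ab(s,t) ds dt
  → 2π det J_ab(p) / √(det(J_ab(p)ᵀJ_ab(p) + J_cd(p)ᵀJ_cd(p)))` as `κ → ∞`. -/
theorem stmt10 (σ : ℝ × ℝ → Fin 4 → ℝ) (hσ : ContDiff ℝ 2 σ)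
    (p : ℝ × ℝ) (hp : p ∈ interior (Set.Icc (0 : ℝ) 1 ×ˢ Set.Icc (0 : ℝ) 1))
    (U : Set (ℝ × ℝ)) (hUopen : IsOpen U) (hUbdd : Bornology.IsBounded U)
    (hUsub : U ⊆ Set.Icc (0 : ℝ) 1 ×ˢ Set.Icc (0 : ℝ) 1) (hpU : p ∈ U)
    (hUx : ∀ q ∈ closure U, q ≠ p → σ q ≠ σ p)
    (a b c d : Fin 4) (hab : a < b) (hcd : c < d)
    (habcd : ({a, b, c, d} : Set (Fin 4)) = Set.univ)
    (hDσ : Function.Injective (fderiv ℝ σ p))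
    (hJ : IsUnit (Jmat σ a b p)) :
    Tendsto (fun κ : ℝ =>
        ∫ q in U, (κ ^ 2 / 4) * Real.exp (-κ ^ 2 * (∑ i, (σ q i - σ p i) ^ 2) / 8) *
          (Jmat σ a b q).det)
      atTop
      (nhds (2 * π * (Jmat σ a b p).det /
        Real.sqrt (((Jmat σ a b p)ᵀ * Jmat σ a b p + (Jmat σ c d p)ᵀ * Jmat σ c d p).det))) := by
  have hC1 : ContDiff ℝ 1 σ := hσ.of_le (by norm_num)
  have hdet : Continuous fun q => (Jmat σ a b q).det := by
    have hf : Continuous (fderiv ℝ σ) := hC1.continuous_fderiv (by norm_num)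
    simp only [Jmat, Matrix.det_fin_two_of]
    fun_prop
  have hL : HasFDerivAt σ (fderiv ℝ σ p) p :=
    (hC1.differentiable (by norm_num)).differentiableAt.hasFDerivAt
  have hmain := tendsto_setIntegral_gaussian_kernel hσ.continuous hL hDσ hUopen hUbdd hpU hUx hdet
  convert hmain using 2
  set L := fderiv ℝ σ p with hLdef
  set u : Fin 4 → ℝ := L (1, 0) with hu
  set w : Fin 4 → ℝ := L (0, 1) with hw
  have hsum : ∀ f : Fin 4 → ℝ, ∑ i, f i = f a + f b + f c + f d := by
    have hsurj : Function.Surjective ![a, b, c, d] := by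
      intro i
      have hi : i ∈ ({a, b, c, d} : Set (Fin 4)) := habcd ▸ Set.mem_univ i
      rcases hi with rfl | rfl | rfl | rfl
      exacts [⟨0, rfl⟩, ⟨1, rfl⟩, ⟨2, rfl⟩, ⟨3, rfl⟩]
    intro f
    rw [← (Finite.injective_iff_surjective.2 hsurj |>.bijective_of_finite).sum_comp f]
    simp [Fin.sum_univ_four]
  have hLv : ∀ v : ℝ × ℝ, ∀ i, L v i = v.1 * u i + v.2 * w i := by
    intro v i
    have hv : v = v.1 • ((1 : ℝ), (0 : ℝ)) + v.2 • ((0 : ℝ), (1 : ℝ)) := by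
      ext <;> simp
    conv_lhs => rw [hv, map_add, map_smul, map_smul]
    simp [hu, hw]
  set A : ℝ := u a ^ 2 + u b ^ 2 + u c ^ 2 + u d ^ 2 with hA
  set B : ℝ := u a * w a + u b * w b + u c * w c + u d * w d with hB
  set C : ℝ := w a ^ 2 + w b ^ 2 + w c ^ 2 + w d ^ 2 with hC
  have hJdet : (Jmat σ a b p).det = u a * w b - w a * u b := by
    simp only [Jmat, Matrix.det_fin_two_of, hu, hw, hLdef]
  have hgram : ((Jmat σ a b p)ᵀ * Jmat σ a b p + (Jmat σ c d p)ᵀ * Jmat σ c d p).det =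
      A * C - B ^ 2 := by
    simp only [Jmat, Matrix.det_fin_two, Matrix.add_apply, Matrix.mul_apply, Fin.sum_univ_two,
      Matrix.transpose_apply, Matrix.of_apply, Matrix.cons_val', Matrix.cons_val_zero,
      Matrix.cons_val_one, Matrix.cons_val_fin_one, ← hLdef, ← hu, ← hw, hA, hB, hC]
    ring
  have hne : u a * w b - w a * u b ≠ 0 :=
    hJdet ▸ ((Matrix.isUnit_iff_isUnit_det _).1 hJ).ne_zero
  have hD : 0 < A * C - B ^ 2 := by
    have hid : A * C - B ^ 2 = (u a * w b - w a * u b) ^ 2 + (u a * w c - w a * u c) ^ 2 +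
        (u a * w d - w a * u d) ^ 2 + (u b * w c - w b * u c) ^ 2 +
        (u b * w d - w b * u d) ^ 2 + (u c * w d - w c * u d) ^ 2 := by
      rw [hA, hB, hC]
      ring
    rw [hid]
    positivity
  have hCpos : 0 < C := by
    have h0 : 0 ≤ C := by positivity
    refine h0.lt_of_ne fun h => ?_
    rw [← h] at hD
    nlinarith [sq_nonneg B]
  have hquad : ∀ v : ℝ × ℝ, -(∑ i, L v i ^ 2) / 8 =
      -(A / 8 * v.1 ^ 2 + 2 * (B / 8) * v.1 * v.2 + C / 8 * v.2 ^ 2) := by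
    intro v
    simp only [hLv, hsum, hA, hB, hC]
    ring
  have hD8 : A / 8 * (C / 8) - (B / 8) ^ 2 = (A * C - B ^ 2) / 8 ^ 2 := by ring
  simp_rw [hquad]
  rw [integral_mul_const, integral_const_mul,
    integral_exp_neg_binary_quadratic (by positivity) (by rw [hD8]; positivity), hD8,
    Real.sqrt_div hD.le, Real.sqrt_sq (by norm_num), hgram]
  have hs : 0 < Real.sqrt (A * C - B ^ 2) := Real.sqrt_pos.2 hD
  field_simp
  ring
end

section
/- (Abelian Wilson Area Law.) Let σ : [0,1]² → ℝ⁴ be a smooth injective map whose differential is injective everywhere, parametrizing a surface S. Then lim_{κ→∞} exp( −(1/(16π)) · Σ_{0≤a<b≤3} ∫_{[0,1]²×[0,1]²} (κ²/4) · |det J_ab(s,t)| · |det J_ab(s̄,t̄)| · e^{−κ²|σ(s,t)−σ(s̄,t̄)|²/8} ds dt ds̄ dt̄ ) = exp( −(1/8) · Σ_{0≤a<b≤3} ∫_{[0,1]²} (det J_ab(s,t))² / √(det(J_ab(s,t)ᵀ J_ab(s,t) + J_cd(s,t)ᵀ J_cd(s,t))) ds dt ) = exp(−(1/8)∫_S ρ_S).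 The left-hand side is the value of the U(1) Yang–Mills path integral E_YM[exp((i/κ)(·, ν_S^κ)_♯)] computed by Gaussian integration, and ∫_S ρ_S equals the area of the surface S. -/
open MeasureTheory Real Filter Matrix

/-- The unit square `[0,1]² ⊆ ℝ²`. -/
def Isq : Set (ℝ × ℝ) := Set.Icc (0 : ℝ) 1 ×ˢ Set.Icc (0 : ℝ) 1

/-- The six quadruples `(a,b,c,d)` with `0 ≤ a < b ≤ 3` and `(c,d)` the complementary pair
(`c < d`, `{a,b,c,d} = {0,1,2,3}`). -/
def quads : List (Fin 4 × Fin 4 × Fin 4 × Fin 4) :=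
  [(0, 1, 2, 3), (0, 2, 1, 3), (0, 3, 1, 2), (1, 2, 0, 3), (1, 3, 0, 2), (2, 3, 0, 1)]

/-- The double surface integral
`Σ_{0≤a<b≤3} (κ²/4) ∫_{I²×I²} e^{−κ²|σ(s,t)−σ(s̄,t̄)|²/8} |det J_ab(s,t)| |det J_ab(s̄,t̄)|`. -/
noncomputable def doubleSum (σ : ℝ × ℝ → Fin 4 → ℝ) (κ : ℝ) : ℝ :=
  (quads.map fun q =>
    (κ ^ 2 / 4) * ∫ st in Isq, ∫ st' in Isq,
      Real.exp (-κ ^ 2 * (∑ i, (σ st i - σ st' i) ^ 2) / 8) *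
        |(Jmat σ q.1 q.2.1 st).det| * |(Jmat σ q.1 q.2.1 st').det|).sum

/-- `∫_S ρ_S = Σ_{0≤a<b≤3} ∫_{I²} (det J_ab)² / √(det(J_abᵀJ_ab + J_cdᵀJ_cd))`, which equals
the area of the surface `S`. -/
noncomputable def rhoIntegral (σ : ℝ × ℝ → Fin 4 → ℝ) : ℝ :=
  (quads.map fun q =>
    ∫ st in Isq, (Jmat σ q.1 q.2.1 st).det ^ 2 /
      Real.sqrt (((Jmat σ q.1 q.2.1 st)ᵀ * Jmat σ q.1 q.2.1 st +
        (Jmat σ q.2.2.1 q.2.2.2 st)ᵀ * Jmat σ q.2.2.1 q.2.2.2 st).det)).sum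

theorem integrable_exp_neg_mul_sq_add_sq {c : ℝ} (hc : 0 < c) :
    Integrable (fun u : ℝ × ℝ => rexp (-(c * (u.1 ^ 2 + u.2 ^ 2)))) := by
  rw [Measure.volume_eq_prod]
  refine ((integrable_exp_neg_mul_sq hc).mul_prod (integrable_exp_neg_mul_sq hc)).congr
    (ae_of_all _ fun u => ?_)
  beta_reduce
  rw [← Real.exp_add]
  ring_nf

theorem integrable_exp_neg_quadratic {A B C : ℝ} (hA : 0 < A) (hD : 0 < A * C - B ^ 2) :
    Integrable (fun u : ℝ × ℝ => rexp (-(A * u.1 ^ 2 + 2 * B * u.1 * u.2 + C * u.2 ^ 2))) := by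
  have hC : 0 < C := pos_of_mul_pos_right (by nlinarith [sq_nonneg B] : 0 < A * C) hA.le
  have hε : 0 < (A * C - B ^ 2) / (A + C) := by positivity
  refine (integrable_exp_neg_mul_sq_add_sq hε).mono' (by fun_prop) (ae_of_all _ fun u => ?_)
  rw [Real.norm_of_nonneg (Real.exp_pos _).le, Real.exp_le_exp, neg_le_neg_iff,
    div_mul_eq_mul_div, div_le_iff₀ (by positivity)]
  nlinarith [sq_nonneg (A * u.1 + B * u.2), sq_nonneg (B * u.1 + C * u.2)]

theorem integral_exp_neg_quadratic {A B C : ℝ} (hA : 0 < A) (hD : 0 < A * C - B ^ 2) :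
    ∫ u : ℝ × ℝ, rexp (-(A * u.1 ^ 2 + 2 * B * u.1 * u.2 + C * u.2 ^ 2)) =
      π / √(A * C - B ^ 2) := by
  have hint := integrable_exp_neg_quadratic hA hD
  rw [Measure.volume_eq_prod] at hint ⊢
  have hinner (y : ℝ) : ∫ x : ℝ, rexp (-(A * x ^ 2 + 2 * B * x * y + C * y ^ 2)) =
      √(π / A) * rexp (-((A * C - B ^ 2) / A) * y ^ 2) := by
    have hsq (x : ℝ) : rexp (-(A * x ^ 2 + 2 * B * x * y + C * y ^ 2)) =
        rexp (-A * (x + B / A * y) ^ 2) * rexp (-((A * C - B ^ 2) / A) * y ^ 2) := by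
      rw [← Real.exp_add]
      congr 1
      field_simp
      ring
    simp_rw [hsq]
    rw [integral_mul_const, integral_add_right_eq_self (fun x => rexp (-A * x ^ 2)),
      integral_gaussian]
  rw [integral_prod_symm _ hint]
  simp_rw [hinner]
  rw [integral_const_mul, integral_gaussian, ← Real.sqrt_mul (by positivity)]
  have hprod : π / A * (π / ((A * C - B ^ 2) / A)) = π ^ 2 / (A * C - B ^ 2) := by
    field_simp
  rw [hprod, Real.sqrt_div (by positivity), Real.sqrt_sq pi_pos.le]

/-- The Gram determinant of the two columns of a linear map `ℝ² → ℝⁿ`. -/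
noncomputable def gramDet {ι : Type*} [Fintype ι] (L : ℝ × ℝ →L[ℝ] (ι → ℝ)) : ℝ :=
  (∑ i, L (1, 0) i ^ 2) * (∑ i, L (0, 1) i ^ 2) - (∑ i, L (1, 0) i * L (0, 1) i) ^ 2

theorem sum_sq_apply {ι : Type*} [Fintype ι] (L : ℝ × ℝ →L[ℝ] (ι → ℝ)) (u : ℝ × ℝ) :
    ∑ i, L u i ^ 2 = (∑ i, L (1, 0) i ^ 2) * u.1 ^ 2 +
      2 * (∑ i, L (1, 0) i * L (0, 1) i) * u.1 * u.2 + (∑ i, L (0, 1) i ^ 2) * u.2 ^ 2 := by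
  have hu : L u = u.1 • L (1, 0) + u.2 • L (0, 1) := by
    rw [← map_smul, ← map_smul, ← map_add]
    simp
  simp only [hu, Pi.add_apply, Pi.smul_apply, smul_eq_mul, Finset.sum_mul, Finset.mul_sum,
    ← Finset.sum_add_distrib]
  exact Finset.sum_congr rfl fun i _ => by ring

theorem sum_sq_pos_of_injective {ι : Type*} [Fintype ι] {L : ℝ × ℝ →L[ℝ] (ι → ℝ)}
    (hL : Function.Injective L) {u : ℝ × ℝ} (hu : u ≠ 0) : 0 < ∑ i, L u i ^ 2 := by
  refine (Finset.sum_nonneg fun i _ => sq_nonneg _).lt_of_ne fun h => hu (hL ?_)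
  rw [map_zero]
  ext i
  simpa using (Finset.sum_eq_zero_iff_of_nonneg fun i _ => sq_nonneg (L u i)).1 h.symm i
    (Finset.mem_univ i)

theorem gramDet_pos {ι : Type*} [Fintype ι] {L : ℝ × ℝ →L[ℝ] (ι → ℝ)}
    (hL : Function.Injective L) : 0 < gramDet L := by
  have hA : 0 < ∑ i, L (1, 0) i ^ 2 := sum_sq_pos_of_injective hL (by simp)
  have h := sum_sq_pos_of_injective hL
    (u := (-∑ i, L (1, 0) i * L (0, 1) i, ∑ i, L (1, 0) i ^ 2)) (by simp [hA.ne'])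
  rw [sum_sq_apply] at h
  refine pos_of_mul_pos_right (a := ∑ i, L (1, 0) i ^ 2) ?_ hA.le
  unfold gramDet
  linarith

theorem integral_exp_neg_sum_sq_div {ι : Type*} [Fintype ι] {L : ℝ × ℝ →L[ℝ] (ι → ℝ)}
    (hL : Function.Injective L) :
    ∫ u, rexp (-(∑ i, L u i ^ 2) / 8) = 8 * π / √(gramDet L) := by
  have hA : 0 < ∑ i, L (1, 0) i ^ 2 := sum_sq_pos_of_injective hL (by simp)
  have hD := gramDet_pos hL
  have hscale : (∑ i, L (1, 0) i ^ 2) / 8 * ((∑ i, L (0, 1) i ^ 2) / 8) -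
      ((∑ i, L (1, 0) i * L (0, 1) i) / 8) ^ 2 = gramDet L / 8 ^ 2 := by
    unfold gramDet
    ring
  have h := integral_exp_neg_quadratic (A := (∑ i, L (1, 0) i ^ 2) / 8)
    (B := (∑ i, L (1, 0) i * L (0, 1) i) / 8) (C := (∑ i, L (0, 1) i ^ 2) / 8) (by positivity)
    (by rw [hscale]; positivity)
  rw [hscale, Real.sqrt_div hD.le, Real.sqrt_sq (by norm_num)] at h
  convert h using 1
  · congr 1 with u
    rw [sum_sq_apply]
    ring_nf
  · field_simp

/-- An injective immersion of a compact subset of a finite-dimensional space is bi-Lipschitz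
onto its image. -/
theorem exists_mul_norm_sub_le_of_injOn {E F : Type*} [NormedAddCommGroup E] [NormedSpace ℝ E]
    [FiniteDimensional ℝ E] [NormedAddCommGroup F] [NormedSpace ℝ F] {f : E → F} {K : Set E}
    (hK : IsCompact K) (hf : ContDiff ℝ 1 f) (hinj : Set.InjOn f K)
    (himm : ∀ x ∈ K, Function.Injective (fderiv ℝ f x)) :
    ∃ ε > 0, ∀ x ∈ K, ∀ y ∈ K, ε * ‖x - y‖ ≤ ‖f x - f y‖ := by
  have key : ∃ ε > 0, ∀ p ∈ K ×ˢ K, ε * ‖p.1 - p.2‖ ≤ ‖f p.1 - f p.2‖ := by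
    refine (hK.prod hK).induction_on (p := fun S : Set (E × E) =>
      ∃ ε > 0, ∀ p ∈ S, ε * ‖p.1 - p.2‖ ≤ ‖f p.1 - f p.2‖) ⟨1, one_pos, by simp⟩ ?_ ?_ ?_
    · rintro S T hST ⟨ε, hε, h⟩
      exact ⟨ε, hε, fun p hp => h p (hST hp)⟩
    · rintro S T ⟨ε, hε, hS⟩ ⟨δ, hδ, hT⟩
      refine ⟨min ε δ, lt_min hε hδ, ?_⟩
      rintro p (hp | hp)
      · exact (mul_le_mul_of_nonneg_right (min_le_left _ _) (norm_nonneg _)).trans (hS p hp)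
      · exact (mul_le_mul_of_nonneg_right (min_le_right _ _) (norm_nonneg _)).trans (hT p hp)
    · rintro ⟨x, y⟩ ⟨hx, hy⟩
      by_cases hxy : x = y
      · subst hxy
        obtain ⟨N, hN, hanti⟩ := (fderiv ℝ f x : E →ₗ[ℝ] F).exists_antilipschitzWith
          (LinearMap.ker_eq_bot.2 (himm x hx))
        obtain ⟨s, hs, happ⟩ := (hf.contDiffAt.hasStrictFDerivAt
          one_ne_zero).approximates_deriv_on_nhds (c := (2 * N)⁻¹) (Or.inr (by positivity))
        refine ⟨s ×ˢ s, mem_nhdsWithin_of_mem_nhds (prod_mem_nhds hs hs), (2 * (N : ℝ))⁻¹,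
          by positivity, ?_⟩
        rintro ⟨a, b⟩ ⟨ha, hb⟩
        have h₁ := hanti.le_mul_dist a b
        have h₂ := happ a ha b hb
        have h₃ := norm_sub_norm_le (fderiv ℝ f x (a - b)) (f a - f b)
        rw [norm_sub_rev _ (f a - f b)] at h₃
        simp only [dist_eq_norm, ContinuousLinearMap.coe_coe, ← map_sub] at h₁
        push_cast at h₂
        have hN' : (0 : ℝ) < N := hN
        have h₄ : (2 * (N : ℝ))⁻¹ * ‖a - b‖ + (2 * (N : ℝ))⁻¹ * ‖a - b‖ ≤
            ‖fderiv ℝ f x (a - b)‖ := by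
          rw [← two_mul, ← mul_assoc, mul_inv, mul_inv_cancel_left₀ two_ne_zero,
            inv_mul_le_iff₀ hN']
          exact h₁
        change (2 * (N : ℝ))⁻¹ * ‖a - b‖ ≤ ‖f a - f b‖
        linarith
      · have hr : 0 < ‖x - y‖ := norm_pos_iff.2 (sub_ne_zero.2 hxy)
        have hδ : 0 < ‖f x - f y‖ :=
          norm_pos_iff.2 (sub_ne_zero.2 fun h => hxy (hinj hx hy h))
        have hlt : ‖f x - f y‖ / (2 * ‖x - y‖) * ‖x - y‖ < ‖f x - f y‖ := by
          field_simp
          linarith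
        have hfc := hf.continuous
        have hopen : IsOpen {p : E × E |
            ‖f x - f y‖ / (2 * ‖x - y‖) * ‖p.1 - p.2‖ < ‖f p.1 - f p.2‖} :=
          isOpen_lt (by fun_prop) (by fun_prop)
        exact ⟨_, mem_nhdsWithin_of_mem_nhds (hopen.mem_nhds hlt), _, by positivity,
          fun p hp => le_of_lt hp⟩
  obtain ⟨ε, hε, h⟩ := key
  exact ⟨ε, hε, fun x hx y hy => h (x, y) ⟨hx, hy⟩⟩

theorem exists_mul_sq_le_sum_sq_sub {ι : Type*} [Fintype ι] {f : ℝ × ℝ → ι → ℝ}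
    {K : Set (ℝ × ℝ)} (hK : IsCompact K) (hf : ContDiff ℝ 1 f) (hinj : Set.InjOn f K)
    (himm : ∀ x ∈ K, Function.Injective (fderiv ℝ f x)) :
    ∃ c > 0, ∀ x ∈ K, ∀ y ∈ K,
      c * ((x.1 - y.1) ^ 2 + (x.2 - y.2) ^ 2) ≤ ∑ i, (f x i - f y i) ^ 2 := by
  obtain ⟨ε, hε, h⟩ := exists_mul_norm_sub_le_of_injOn hK hf hinj himm
  refine ⟨ε ^ 2 / 2, by positivity, fun x hx y hy => ?_⟩
  have h₁ : (x.1 - y.1) ^ 2 ≤ ‖x - y‖ ^ 2 := by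
    rw [← sq_abs]
    exact pow_le_pow_left₀ (abs_nonneg _) (norm_fst_le (x - y)) 2
  have h₂ : (x.2 - y.2) ^ 2 ≤ ‖x - y‖ ^ 2 := by
    rw [← sq_abs]
    exact pow_le_pow_left₀ (abs_nonneg _) (norm_snd_le (x - y)) 2
  have h₃ : ‖f x - f y‖ ≤ √(∑ i, (f x i - f y i) ^ 2) := by
    refine (pi_norm_le_iff_of_nonneg (Real.sqrt_nonneg _)).2 fun i => Real.abs_le_sqrt ?_
    exact Finset.single_le_sum (f := fun i => (f x i - f y i) ^ 2) (fun i _ => sq_nonneg _)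
      (Finset.mem_univ i)
  calc ε ^ 2 / 2 * ((x.1 - y.1) ^ 2 + (x.2 - y.2) ^ 2)
      ≤ ε ^ 2 / 2 * (‖x - y‖ ^ 2 + ‖x - y‖ ^ 2) := by gcongr
    _ = (ε * ‖x - y‖) ^ 2 := by ring
    _ ≤ √(∑ i, (f x i - f y i) ^ 2) ^ 2 := by
      gcongr
      exact (h x hx y hy).trans h₃
    _ = _ := Real.sq_sqrt (Finset.sum_nonneg fun i _ => sq_nonneg _)

theorem sq_mul_setIntegral_eq {K : Set (ℝ × ℝ)} (hK : MeasurableSet K) (g : ℝ × ℝ → ℝ)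
    (x : ℝ × ℝ) (κ : ℝ) :
    κ ^ 2 * ∫ y in K, g y = ∫ u, K.indicator g (x + κ⁻¹ • u) := by
  rw [Measure.integral_comp_smul volume (fun v => K.indicator g (x + v)),
    integral_add_left_eq_self, integral_indicator hK]
  simp

/-- The integrand of the surface self-interaction with Gaussian kernel at scale `1 / κ`. -/
noncomputable def gaussKernel {ι : Type*} [Fintype ι] (f : ℝ × ℝ → ι → ℝ) (h : ℝ × ℝ → ℝ)
    (κ : ℝ) (x y : ℝ × ℝ) : ℝ :=
  rexp (-κ ^ 2 * (∑ i, (f x i - f y i) ^ 2) / 8) * h x * h y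

theorem abs_indicator_gaussKernel_le {ι : Type*} [Fintype ι] {f : ℝ × ℝ → ι → ℝ}
    {h : ℝ × ℝ → ℝ} {K : Set (ℝ × ℝ)} {c M κ : ℝ}
    (hbi : ∀ x ∈ K, ∀ y ∈ K,
      c * ((x.1 - y.1) ^ 2 + (x.2 - y.2) ^ 2) ≤ ∑ i, (f x i - f y i) ^ 2)
    (hM : ∀ x ∈ K, |h x| ≤ M) (hκ : 0 < κ) {x : ℝ × ℝ} (hx : x ∈ K) (u : ℝ × ℝ) :
    |K.indicator (gaussKernel f h κ x) (x + κ⁻¹ • u)| ≤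
      M * M * rexp (-(c / 8 * (u.1 ^ 2 + u.2 ^ 2))) := by
  have hM0 : 0 ≤ M := (abs_nonneg _).trans (hM x hx)
  by_cases hy : x + κ⁻¹ • u ∈ K
  · have hle := mul_le_mul_of_nonneg_left (hbi x hx _ hy) (sq_nonneg κ)
    have heq : κ ^ 2 * (c * ((x.1 - (x + κ⁻¹ • u).1) ^ 2 + (x.2 - (x + κ⁻¹ • u).2) ^ 2)) =
        c * (u.1 ^ 2 + u.2 ^ 2) := by
      simp only [Prod.fst_add, Prod.snd_add, Prod.smul_fst, Prod.smul_snd, smul_eq_mul]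
      field_simp
      ring
    rw [Set.indicator_of_mem hy, gaussKernel, abs_mul, abs_mul, Real.abs_exp, mul_assoc,
      mul_comm (M * M)]
    gcongr ?_ * (?_ * ?_)
    · rw [Real.exp_le_exp]
      linarith
    · exact hM x hx
    · exact hM _ hy
  · rw [Set.indicator_of_notMem hy, abs_zero]
    positivity

theorem tendsto_indicator_gaussKernel {ι : Type*} [Fintype ι] {f : ℝ × ℝ → ι → ℝ}
    {h : ℝ × ℝ → ℝ} {K : Set (ℝ × ℝ)} {x : ℝ × ℝ} (hx : x ∈ interior K)
    (hf : DifferentiableAt ℝ f x) (hh : ContinuousAt h x) (u : ℝ × ℝ) :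
    Tendsto (fun κ : ℝ => K.indicator (gaussKernel f h κ x) (x + κ⁻¹ • u)) atTop
      (nhds (rexp (-(∑ i, fderiv ℝ f x u i ^ 2) / 8) * h x ^ 2)) := by
  have hy : Tendsto (fun κ : ℝ => x + κ⁻¹ • u) atTop (nhds x) := by
    simpa using (tendsto_const_nhds (x := x)).add ((tendsto_inv_atTop_zero (𝕜 := ℝ)).smul_const u)
  have hlim := hf.hasFDerivAt.lim u (c := fun κ : ℝ => κ) (l := atTop) tendsto_norm_atTop_atTop
  have hmain : Tendsto (fun κ : ℝ =>
      rexp (-(∑ i, (κ • (f (x + κ⁻¹ • u) - f x)) i ^ 2) / 8) * h x * h (x + κ⁻¹ • u)) atTop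
      (nhds (rexp (-(∑ i, fderiv ℝ f x u i ^ 2) / 8) * h x * h x)) := by
    refine Tendsto.mul (Tendsto.mul_const _ ?_) (hh.tendsto.comp hy)
    refine (Real.continuous_exp.tendsto _).comp (Tendsto.div_const (Tendsto.neg ?_) _)
    exact tendsto_finsetSum _ fun i _ => ((tendsto_pi_nhds.1 hlim) i).pow 2
  rw [sq, ← mul_assoc]
  refine hmain.congr' ?_
  filter_upwards [hy (mem_interior_iff_mem_nhds.1 hx)] with κ hκ
  rw [Set.indicator_of_mem (Set.mem_preimage.1 hκ), gaussKernel, neg_mul, Finset.mul_sum]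
  congr 5
  refine Finset.sum_congr rfl fun i _ => ?_
  simp only [Pi.smul_apply, Pi.sub_apply, smul_eq_mul]
  ring

/-- Laplace asymptotics of the Gaussian self-interaction of an embedded compact surface. -/
theorem tendsto_setIntegral_gaussKernel {ι : Type*} [Fintype ι] {f : ℝ × ℝ → ι → ℝ}
    {h : ℝ × ℝ → ℝ} {K : Set (ℝ × ℝ)} (hK : IsCompact K) (hKfr : volume (frontier K) = 0)
    (hf : ContDiff ℝ 1 f) (hinj : Set.InjOn f K)
    (himm : ∀ x ∈ K, Function.Injective (fderiv ℝ f x)) (hh : Continuous h) :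
    Tendsto (fun κ : ℝ => κ ^ 2 / 4 * ∫ x in K, ∫ y in K, gaussKernel f h κ x y) atTop
      (nhds (2 * π * ∫ x in K, h x ^ 2 / √(gramDet (fderiv ℝ f x)))) := by
  obtain ⟨c, hc, hbi⟩ := exists_mul_sq_le_sum_sq_sub hK hf hinj himm
  obtain ⟨M, hM⟩ := hK.exists_bound_of_continuousOn hh.continuousOn
  have hint : Integrable fun u : ℝ × ℝ => M * M * rexp (-(c / 8 * (u.1 ^ 2 + u.2 ^ 2))) :=
    (integrable_exp_neg_mul_sq_add_sq (by positivity)).const_mul _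
  have hcont (κ : ℝ) : Continuous (Function.uncurry (gaussKernel f h κ)) := by
    have := hf.continuous
    unfold gaussKernel Function.uncurry
    fun_prop
  have hinner {x : ℝ × ℝ} (hx : x ∈ interior K) :
      Tendsto (fun κ : ℝ => κ ^ 2 * ∫ y in K, gaussKernel f h κ x y) atTop
        (nhds (8 * π * (h x ^ 2 / √(gramDet (fderiv ℝ f x))))) := by
    have hlim : 8 * π * (h x ^ 2 / √(gramDet (fderiv ℝ f x))) =
        ∫ u, rexp (-(∑ i, fderiv ℝ f x u i ^ 2) / 8) * h x ^ 2 := by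
      rw [integral_mul_const, integral_exp_neg_sum_sq_div (himm x (interior_subset hx))]
      ring
    simp_rw [sq_mul_setIntegral_eq hK.measurableSet _ x]
    rw [hlim]
    refine tendsto_integral_filter_of_dominated_convergence _ (Eventually.of_forall fun κ => ?_)
      ?_ hint (ae_of_all _ (tendsto_indicator_gaussKernel hx
        (hf.differentiable one_ne_zero x) hh.continuousAt))
    · have hmeas : Measurable (K.indicator (gaussKernel f h κ x)) :=
        ((hcont κ).comp (Continuous.prodMk_right x)).measurable.indicator hK.measurableSet
      exact (hmeas.comp (by fun_prop)).aestronglyMeasurable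
    · filter_upwards [eventually_gt_atTop 0] with κ hκ
      exact ae_of_all _ (abs_indicator_gaussKernel_le hbi hM hκ (interior_subset hx))
  have hae : ∀ᵐ x ∂volume.restrict K, x ∈ interior K := by
    rw [ae_restrict_iff' hK.measurableSet]
    filter_upwards [measure_eq_zero_iff_ae_notMem.1 hKfr] with x hx hxK
    by_contra hxi
    exact hx ⟨subset_closure hxK, hxi⟩
  have houter : Tendsto (fun κ : ℝ => ∫ x in K, κ ^ 2 * ∫ y in K, gaussKernel f h κ x y) atTop
      (nhds (∫ x in K, 8 * π * (h x ^ 2 / √(gramDet (fderiv ℝ f x))))) := by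
    refine tendsto_integral_filter_of_dominated_convergence
      (fun _ => ∫ u : ℝ × ℝ, M * M * rexp (-(c / 8 * (u.1 ^ 2 + u.2 ^ 2))))
      (Eventually.of_forall fun κ => ?_) ?_ ?_ ?_
    · exact ((hcont κ).stronglyMeasurable.integral_prod_right'.const_mul _).aestronglyMeasurable
    · filter_upwards [eventually_gt_atTop 0] with κ hκ
      refine (ae_restrict_iff' hK.measurableSet).2 (ae_of_all _ fun x hx => ?_)
      rw [sq_mul_setIntegral_eq hK.measurableSet _ x]
      exact norm_integral_le_of_norm_le hint
        (ae_of_all _ (abs_indicator_gaussKernel_le hbi hM hκ hx))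
    · exact integrableOn_const hK.measure_lt_top.ne
    · filter_upwards [hae] with x hx using hinner hx
  simp_rw [integral_const_mul] at houter
  convert houter.const_mul (1 / 4) using 2 <;> ring

theorem continuous_det_Jmat {σ : ℝ × ℝ → Fin 4 → ℝ} (hσ : ContDiff ℝ 1 σ) (a b : Fin 4) :
    Continuous fun q => (Jmat σ a b q).det := by
  have hd := hσ.continuous_fderiv one_ne_zero
  simp only [Jmat, det_fin_two_of]
  fun_prop

theorem det_Jmat_gram {σ : ℝ × ℝ → Fin 4 → ℝ} {a b c d : Fin 4} (h : (a, b, c, d) ∈ quads)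
    (q : ℝ × ℝ) :
    ((Jmat σ a b q)ᵀ * Jmat σ a b q + (Jmat σ c d q)ᵀ * Jmat σ c d q).det =
      gramDet (fderiv ℝ σ q) := by
  simp only [quads, List.mem_cons, Prod.mk.injEq, List.not_mem_nil, or_false] at h
  rcases h with ⟨rfl, rfl, rfl, rfl⟩ | ⟨rfl, rfl, rfl, rfl⟩ | ⟨rfl, rfl, rfl, rfl⟩ |
      ⟨rfl, rfl, rfl, rfl⟩ | ⟨rfl, rfl, rfl, rfl⟩ | ⟨rfl, rfl, rfl, rfl⟩ <;>
    simp [gramDet, Jmat, det_fin_two, Matrix.mul_apply, Fin.sum_univ_four] <;>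
    ring

/-- Abelian Wilson Area Law: for a smooth injective parametrization `σ` of a surface `S ⊆ ℝ⁴`
with everywhere injective differential, the Gaussian value of the `U(1)` Yang–Mills path
integral `exp(−(1/(16π)) Σ_{a<b} ∫∫ (κ²/4)|det J_ab||det J_ab| e^{−κ²|σ−σ̄|²/8})` converges, as
`κ → ∞`, to `exp(−(1/8) ∫_S ρ_S)`, where `∫_S ρ_S` is the area of `S`. -/
theorem stmt12 (σ : ℝ × ℝ → Fin 4 → ℝ) (hσ : ContDiff ℝ (⊤ : ℕ∞) σ)
    (hinj : Set.InjOn σ Isq)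
    (himm : ∀ q ∈ Isq, Function.Injective (fderiv ℝ σ q)) :
    Tendsto (fun κ : ℝ => Real.exp (-(1 / (16 * π)) * doubleSum σ κ)) atTop
      (nhds (Real.exp (-(1 / 8) * rhoIntegral σ))) := by
  have hσ' : ContDiff ℝ 1 σ := hσ.of_le (by exact_mod_cast le_top)
  have hcpt : IsCompact Isq := isCompact_Icc.prod isCompact_Icc
  have hconv : Convex ℝ Isq := (convex_Icc 0 1).prod (convex_Icc 0 1)
  have hsum : Tendsto (doubleSum σ) atTop (nhds (2 * π * rhoIntegral σ)) := by
    rw [rhoIntegral, ← List.sum_map_mul_left]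
    refine tendsto_list_sum quads fun q hq => ?_
    have hq' := tendsto_setIntegral_gaussKernel hcpt (hconv.addHaar_frontier volume) hσ' hinj
      himm (continuous_det_Jmat hσ' q.1 q.2.1).abs
    simpa only [gaussKernel, sq_abs, det_Jmat_gram hq] using hq'
  refine (Real.continuous_exp.tendsto _).comp ?_
  convert hsum.const_mul (-(1 / (16 * π))) using 2
  field_simp
  ring
end
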